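/- arXiv:2604.08152 — 2 statements merged into one kernel-verified Lean document; each statement's English description precedes it below -/
import Mathlib

section
/- Let n ≥ 1, q > 1 and α > 0 with (1+α)q < n. Then there is a constant C (depending only on n, q, α) such that for every smooth compactly supported φ : ℝⁿ → ℝ with ∇φ not identically zero and every x ∈ ℝⁿ, Σ_{k∈ℤ} 2^{k(1+α)} ( (1/|B(x,2^k)|) ∫_{B(x,2^k)} |∇φ(y)|^q dy )^{1/q} ≤ C (M(|∇φ|^q)(x))^{1/q − (1+α)/n} ‖∇φ‖_{L^q(ℝⁿ)}^{q(1+α)/n}, where B(x,r) is the open ball of center x and radius r. -/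
open MeasureTheory Real Filter Metric
open scoped ENNReal Topology

noncomputable section

/-- `ℝⁿ` as a Euclidean space. -/
abbrev En (n : ℕ) := EuclideanSpace ℝ (Fin n)

/-- The (uncentered) Hardy–Littlewood maximal function of `g`, with values in `[0,∞]`:
`M(g)(x) = sup { (1/|B|) ∫_B |g| : B open ball containing x }`. -/
def maximalFn (n : ℕ) (g : En n → ℝ) (x : En n) : ℝ≥0∞ :=
  ⨆ (z : En n) (r : ℝ) (_ : 0 < r) (_ : x ∈ ball z r),
    (volume (ball z r))⁻¹ * ∫⁻ y in ball z r, ENNReal.ofReal |g y|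

/-- A dyadic sum whose `k`-th term is dominated both by `2 ^ (k s) a` and by `2 ^ (k (s - b)) d`,
with `0 < s < b`, is controlled by the interpolated quantity `a ^ (1 - s / b) d ^ (s / b)`. -/
theorem exists_tsum_dyadic_le {s b : ℝ} (hs : 0 < s) (hsb : s < b) :
    ∃ C > (0 : ℝ), ∀ (a d : ℝ), 0 < a → 0 < d → ∀ f : ℤ → ℝ≥0∞,
      (∀ k : ℤ, f k ≤ ENNReal.ofReal ((2 : ℝ) ^ ((k : ℝ) * s) * a)) →
      (∀ k : ℤ, f k ≤ ENNReal.ofReal ((2 : ℝ) ^ ((k : ℝ) * (s - b)) * d)) →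
      ∑' k, f k ≤ ENNReal.ofReal (C * (a ^ (1 - s / b) * d ^ (s / b))) := by
  have hb : 0 < b := hs.trans hsb
  obtain ⟨δ, hδ, hδs, hδb⟩ : ∃ δ : ℝ, 0 < δ ∧ δ ≤ s ∧ δ ≤ b - s :=
    ⟨min s (b - s), lt_min hs (by linarith), min_le_left _ _, min_le_right _ _⟩
  let c : ℤ → ℝ := fun j => (2 : ℝ) ^ (b - s) * ((2 : ℝ) ^ (-δ)) ^ j.natAbs
  have hc0 : ∀ j, 0 < c j := fun j => by positivity
  have hρ : (2 : ℝ) ^ (-δ) < 1 := Real.rpow_lt_one_of_one_lt_of_neg one_lt_two (by linarith)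
  have hcs : Summable c := by
    refine Summable.mul_left _ (Summable.of_nat_of_neg ?_ ?_) <;>
      simpa using summable_geometric_of_lt_one (by positivity : (0 : ℝ) ≤ 2 ^ (-δ)) hρ
  refine ⟨∑' j, c j, hcs.tsum_pos (fun j => (hc0 j).le) 0 (hc0 0), fun a d ha hd f hfa hfd => ?_⟩
  obtain ⟨l, hl⟩ : ∃ l : ℝ, (2 : ℝ) ^ (l * b) = d / a :=
    ⟨Real.logb 2 (d / a) / b, by
      rw [div_mul_cancel₀ _ hb.ne', Real.rpow_logb two_pos (by norm_num) (div_pos hd ha)]⟩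
  have hd' : d = 2 ^ (l * b) * a := by rw [hl]; field_simp
  have hval : a ^ (1 - s / b) * d ^ (s / b) = 2 ^ (l * s) * a := by
    rw [hd', Real.mul_rpow (by positivity) ha.le, ← Real.rpow_mul zero_le_two,
      mul_left_comm, ← Real.rpow_add ha]
    rw [sub_add_cancel, Real.rpow_one]
    congr 2
    field_simp
  have hm1 : (⌊l⌋ : ℝ) ≤ l := Int.floor_le l
  have hm2 : l < ⌊l⌋ + 1 := Int.lt_floor_add_one l
  have key : ∀ j : ℤ, f (j + ⌊l⌋) ≤ ENNReal.ofReal (c j * (2 ^ (l * s) * a)) := by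
    intro j
    have hcj : c j = 2 ^ (b - s - δ * |(j : ℝ)|) := by
      simp only [c]
      rw [← Real.rpow_natCast, ← Real.rpow_mul zero_le_two, ← Real.rpow_add two_pos,
        Nat.cast_natAbs, Int.cast_abs]
      congr 1
      ring
    rcases le_or_gt j 0 with hj | hj
    · refine (hfa _).trans (ENNReal.ofReal_le_ofReal ?_)
      rw [← mul_assoc]
      refine mul_le_mul_of_nonneg_right ?_ ha.le
      rw [hcj, ← Real.rpow_add two_pos]
      refine Real.rpow_le_rpow_of_exponent_le one_le_two ?_
      have hj' : (j : ℝ) ≤ 0 := by exact_mod_cast hj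
      rw [abs_of_nonpos hj']
      push_cast
      nlinarith
    · refine (hfd _).trans (ENNReal.ofReal_le_ofReal ?_)
      rw [hd', ← mul_assoc, ← mul_assoc]
      refine mul_le_mul_of_nonneg_right ?_ ha.le
      rw [hcj, ← Real.rpow_add two_pos, ← Real.rpow_add two_pos]
      refine Real.rpow_le_rpow_of_exponent_le one_le_two ?_
      have hj' : (0 : ℝ) < j := by exact_mod_cast hj
      rw [abs_of_pos hj']
      push_cast
      nlinarith
  calc ∑' k, f k = ∑' j, f (j + ⌊l⌋) := ((Equiv.addRight ⌊l⌋).tsum_eq f).symm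
    _ ≤ ∑' j, ENNReal.ofReal (c j * (2 ^ (l * s) * a)) := ENNReal.tsum_le_tsum key
    _ = ENNReal.ofReal (∑' j, c j * (2 ^ (l * s) * a)) :=
      (ENNReal.ofReal_tsum_of_nonneg (fun j => by have := hc0 j; positivity)
        (hcs.mul_right _)).symm
    _ = _ := by rw [tsum_mul_right, hval]

theorem ContDiff.continuous_gradient {F : Type*} [NormedAddCommGroup F] [InnerProductSpace ℝ F]
    [CompleteSpace F] {φ : F → ℝ} {m : WithTop ℕ∞} (hφ : ContDiff ℝ m φ) (hm : m ≠ 0) :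
    Continuous (gradient φ) :=
  (InnerProductSpace.toDual ℝ F).symm.continuous.comp (hφ.continuous_fderiv hm)

theorem HasCompactSupport.gradient {F : Type*} [NormedAddCommGroup F] [InnerProductSpace ℝ F]
    [CompleteSpace F] {φ : F → ℝ} (hφ : HasCompactSupport φ) :
    HasCompactSupport (gradient φ) :=
  (hφ.fderiv (𝕜 := ℝ)).comp_left (map_zero (InnerProductSpace.toDual ℝ F).symm)

/-- The average of `g` over a ball centred at `x` is at most the maximal function at `x`. -/
theorem average_ball_le_maximalFn {n : ℕ} (g : En n → ℝ) (x : En n) {r : ℝ} (hr : 0 < r) :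
    (volume (ball x r))⁻¹ * ∫⁻ y in ball x r, ENNReal.ofReal |g y| ≤ maximalFn n g x :=
  le_iSup_of_le x <| le_iSup_of_le r <| le_iSup_of_le hr <|
    le_iSup_of_le (mem_ball_self hr) le_rfl

theorem toReal_eLpNorm_rpow {X E : Type*} [MeasurableSpace X] {μ : Measure X}
    [NormedAddCommGroup E] (g : X → E) {q : ℝ} (hq : 0 < q) (t : ℝ) :
    (eLpNorm g (ENNReal.ofReal q) μ).toReal ^ (q * t) =
      (∫⁻ y, ENNReal.ofReal (‖g y‖ ^ q) ∂μ).toReal ^ t := by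
  rw [eLpNorm_eq_lintegral_rpow_enorm_toReal (by simpa using hq) ENNReal.ofReal_ne_top,
    ENNReal.toReal_ofReal hq.le, ← ENNReal.toReal_rpow,
    ← Real.rpow_mul ENNReal.toReal_nonneg, one_div, inv_mul_cancel_left₀ hq.ne']
  simp only [← ofReal_norm, ENNReal.ofReal_rpow_of_nonneg (norm_nonneg _) hq.le]


/-- For `n ≥ 1`, `q > 1`, `α > 0` with `(1+α)q < n`, there is `C` such
that for every smooth compactly supported `φ` with `∇φ` not identically zero and every `x`,
`Σ_{k∈ℤ} 2^{k(1+α)} ((1/|B(x,2^k)|) ∫_{B(x,2^k)} |∇φ|^q)^{1/q}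
  ≤ C (M(|∇φ|^q)(x))^{1/q−(1+α)/n} ‖∇φ‖_{L^q}^{q(1+α)/n}` (in `[0,∞]`). -/
theorem dyadic_ball_sum_maximal_bound (n : ℕ) (hn : 1 ≤ n) (q α : ℝ)
    (hq : 1 < q) (hα : 0 < α) (h : (1 + α) * q < n) :
    ∃ C > (0 : ℝ), ∀ φ : En n → ℝ, ContDiff ℝ (⊤ : ℕ∞) φ → HasCompactSupport φ →
      (¬ ∀ x : En n, gradient φ x = 0) → ∀ x : En n,
      (∑' k : ℤ, ENNReal.ofReal ((2 : ℝ) ^ ((k : ℝ) * (1 + α))) *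
          ((volume (ball x ((2 : ℝ) ^ k)))⁻¹ *
            ∫⁻ y in ball x ((2 : ℝ) ^ k), ENNReal.ofReal (‖gradient φ y‖ ^ q)) ^ (1 / q)) ≤
        ENNReal.ofReal C *
          (maximalFn n (fun y => ‖gradient φ y‖ ^ q) x) ^ (1 / q - (1 + α) / (n : ℝ)) *
          ENNReal.ofReal
            ((eLpNorm (fun y : En n => gradient φ y) (ENNReal.ofReal q) volume).toReal ^
              (q * (1 + α) / (n : ℝ))) := by
  have hn0 : (0 : ℝ) < n := by exact_mod_cast hn
  have hq0 : 0 < q := by linarith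
  have hs : 0 < 1 + α := by linarith
  have hsb : 1 + α < n / q := (lt_div_iff₀ hq0).2 h
  have hexp : 0 < 1 / q - (1 + α) / (n : ℝ) := by
    rw [sub_pos, div_lt_div_iff₀ hn0 hq0]
    linarith
  obtain ⟨C, hC, hsum⟩ := exists_tsum_dyadic_le hs hsb
  obtain ⟨v, hv⟩ : ∃ v : ℝ, v = (volume (ball (0 : En n) 1)).toReal := ⟨_, rfl⟩
  have hv0 : 0 < v := hv ▸ ENNReal.toReal_pos (measure_ball_pos _ _ one_pos).ne'
    measure_ball_lt_top.ne
  have hvol : volume (ball (0 : En n) 1) = ENNReal.ofReal v := by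
    rw [hv, ENNReal.ofReal_toReal measure_ball_lt_top.ne]
  refine ⟨C * (v⁻¹) ^ ((1 + α) / n), by positivity, fun φ hφ hsupp _ x => ?_⟩
  have hLp : MemLp (fun y : En n => gradient φ y) (ENNReal.ofReal q) volume :=
    (hφ.continuous_gradient (by simp)).memLp_of_hasCompactSupport hsupp.gradient
  rw [mul_div_assoc, toReal_eLpNorm_rpow _ hq0]
  have hfin : ∫⁻ y, ENNReal.ofReal (‖gradient φ y‖ ^ q) ≠ ∞ := by
    have := lintegral_rpow_enorm_lt_top_of_eLpNorm_lt_top (by simpa using hq0)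
      ENNReal.ofReal_ne_top hLp.2
    rw [ENNReal.toReal_ofReal hq0.le] at this
    simpa only [← ofReal_norm, ENNReal.ofReal_rpow_of_nonneg (norm_nonneg _) hq0.le] using this.ne
  obtain ⟨I, hI⟩ : ∃ I, I = ∫⁻ y, ENNReal.ofReal (‖gradient φ y‖ ^ q) := ⟨_, rfl⟩
  obtain ⟨A, hA⟩ : ∃ A, A = maximalFn n (fun y => ‖gradient φ y‖ ^ q) x := ⟨_, rfl⟩
  obtain ⟨u, hu⟩ : ∃ u : ℤ → ℝ≥0∞, ∀ k, u k = (volume (ball x ((2 : ℝ) ^ k)))⁻¹ *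
      ∫⁻ y in ball x ((2 : ℝ) ^ k), ENNReal.ofReal (‖gradient φ y‖ ^ q) := ⟨_, fun _ => rfl⟩
  have huA : ∀ k, u k ≤ A := fun k => by
    have := average_ball_le_maximalFn (fun y => ‖gradient φ y‖ ^ q) x
      (zpow_pos two_pos k : (0 : ℝ) < 2 ^ k)
    simp only [abs_of_nonneg (Real.rpow_nonneg (norm_nonneg _) q)] at this
    rwa [hu, hA]
  have huI : ∀ k : ℤ, u k ≤ (ENNReal.ofReal ((2 : ℝ) ^ ((k : ℝ) * n) * v))⁻¹ * I := fun k => by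
    have hball : volume (ball x ((2 : ℝ) ^ k)) = ENNReal.ofReal ((2 : ℝ) ^ ((k : ℝ) * n) * v) := by
      rw [Measure.addHaar_ball_of_pos _ _ (by positivity), hvol, finrank_euclideanSpace_fin,
        ENNReal.ofReal_mul (by positivity), Real.rpow_mul zero_le_two, Real.rpow_intCast,
        Real.rpow_natCast]
    rw [hu, hI, hball]
    gcongr
    exact Measure.restrict_le_self
  simp only [← hu, ← hI, ← hA]
  rw [← hI] at hfin
  have htriv : (∀ k, u k = 0) →
      ∑' k : ℤ, ENNReal.ofReal ((2 : ℝ) ^ ((k : ℝ) * (1 + α))) * u k ^ (1 / q) = 0 := fun h0 => by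
    simp [h0, hq0]
  rcases eq_or_ne I 0 with hI0 | hI0
  · rw [htriv fun k => by simpa [hI0] using huI k]
    exact zero_le
  rcases eq_or_ne A 0 with hA0 | hA0
  · rw [htriv fun k => by simpa [hA0] using huA k]
    exact zero_le
  have hIpos : 0 < I.toReal := ENNReal.toReal_pos hI0 hfin
  rcases eq_or_ne A ∞ with hAt | hAt
  · rw [hAt, ENNReal.top_rpow_of_pos hexp, ENNReal.mul_top, ENNReal.top_mul]
    · exact le_top
    · rw [Ne, ENNReal.ofReal_eq_zero, not_le]
      positivity
    · rw [Ne, ENNReal.ofReal_eq_zero, not_le]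
      positivity
  have hApos : 0 < A.toReal := ENNReal.toReal_pos hA0 hAt
  have hAr : A = ENNReal.ofReal A.toReal := (ENNReal.ofReal_toReal hAt).symm
  have hIr : I = ENNReal.ofReal I.toReal := (ENNReal.ofReal_toReal hfin).symm
  generalize A.toReal = a at *
  generalize I.toReal = i at *
  subst hAr hIr
  have hq' : 0 ≤ 1 / q := by positivity
  refine (hsum (a ^ (1 / q)) ((v⁻¹ * i) ^ (1 / q)) (by positivity) (by positivity) _
    (fun k => ?_) (fun k => ?_)).trans (le_of_eq ?_)
  · rw [ENNReal.ofReal_mul (by positivity), ← ENNReal.ofReal_rpow_of_nonneg hApos.le hq']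
    gcongr
    exact huA k
  · have hpow : (2 : ℝ) ^ ((k : ℝ) * (1 + α - n / q)) * (v⁻¹ * i) ^ (1 / q) =
        2 ^ ((k : ℝ) * (1 + α)) * (((2 : ℝ) ^ ((k : ℝ) * n) * v)⁻¹ * i) ^ (1 / q) := by
      rw [mul_inv, mul_assoc (_⁻¹) (_⁻¹), ← Real.rpow_neg zero_le_two,
        Real.mul_rpow (Real.rpow_nonneg zero_le_two (-((k : ℝ) * n)))
          (by positivity : 0 ≤ v⁻¹ * i), ← Real.rpow_mul zero_le_two, ← mul_assoc,
        ← Real.rpow_add two_pos]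
      congr 2
      ring
    rw [hpow, ENNReal.ofReal_mul (by positivity),
      ← ENNReal.ofReal_rpow_of_nonneg (by positivity) hq',
      ENNReal.ofReal_mul (by positivity), ENNReal.ofReal_inv_of_pos (by positivity)]
    gcongr
    exact huI k
  · rw [ENNReal.ofReal_rpow_of_nonneg hApos.le hexp.le, ← ENNReal.ofReal_mul (by positivity),
      ← ENNReal.ofReal_mul (by positivity), ← Real.rpow_mul hApos.le,
      ← Real.rpow_mul (by positivity), show 1 / q * (1 - (1 + α) / (n / q)) =
        1 / q - (1 + α) / n by field_simp,
      show 1 / q * ((1 + α) / (n / q)) = (1 + α) / n by field_simp,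
      Real.mul_rpow (by positivity) hIpos.le]
    congr 1
    ring
end
end

section
/- Let n ≥ 1, q > 1 and α > 0 with (1+α)q < n. Then there is a constant C (depending only on n, q, α) such that for every smooth compactly supported φ : ℝⁿ → ℝ with ∇φ not identically zero and every x ∈ ℝⁿ, the dyadic annulus sum satisfies Σ_{k∈ℤ} 2^{k(1+α)} ( (1/|B(x,2^k)|) ∫_{{2^{k−1} ≤ |x−y| ≤ 2^k}} |∇φ(y)|^q dy )^{1/q} ≤ C (M(|∇φ|^q)(x))^{1/q − (1+α)/n} ‖∇φ‖_{L^q(ℝⁿ)}^{q(1+α)/n}, where B(x,r) is the open ball of center x and radius r. -/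
open MeasureTheory Real Filter Metric
open scoped ENNReal Topology

noncomputable section

/-- A dyadic annulus average is controlled by the maximal function, at the cost of the doubling
constant `2 ^ n`. -/
lemma annulus_average_le_maximalFn (n : ℕ) (g : En n → ℝ) (x : En n) (k : ℤ) :
    (volume (ball x ((2 : ℝ) ^ k)))⁻¹ *
        ∫⁻ y in {y : En n | (2 : ℝ) ^ (k - 1) ≤ ‖x - y‖ ∧ ‖x - y‖ ≤ (2 : ℝ) ^ k},
          ENNReal.ofReal (g y) ≤
      ENNReal.ofReal (2 ^ n) * maximalFn n g x := by
  have hk : (0 : ℝ) < 2 ^ k := by positivity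
  have hk' : (0 : ℝ) < 2 ^ (k + 1) := by positivity
  have hvol : (volume (ball x ((2 : ℝ) ^ k)))⁻¹ =
      ENNReal.ofReal (2 ^ n) * (volume (ball x ((2 : ℝ) ^ (k + 1))))⁻¹ := by
    have hdouble : volume (ball x ((2 : ℝ) ^ (k + 1))) =
        ENNReal.ofReal (2 ^ n) * volume (ball x ((2 : ℝ) ^ k)) := by
      rw [Measure.addHaar_ball_of_pos _ _ hk, Measure.addHaar_ball_of_pos _ _ hk', ← mul_assoc,
        ← ENNReal.ofReal_mul (by positivity), zpow_add_one₀ (by norm_num), mul_pow,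
        finrank_euclideanSpace_fin, mul_comm ((2 : ℝ) ^ n)]
    have h2 : ENNReal.ofReal (2 ^ n) ≠ 0 := by simp
    rw [hdouble, ENNReal.mul_inv (.inl h2) (.inl ENNReal.ofReal_ne_top), ← mul_assoc,
      ENNReal.mul_inv_cancel h2 ENNReal.ofReal_ne_top, one_mul]
  rw [hvol, mul_assoc]
  gcongr
  calc (volume (ball x ((2 : ℝ) ^ (k + 1))))⁻¹ *
        ∫⁻ y in {y : En n | (2 : ℝ) ^ (k - 1) ≤ ‖x - y‖ ∧ ‖x - y‖ ≤ (2 : ℝ) ^ k},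
          ENNReal.ofReal (g y)
      ≤ (volume (ball x ((2 : ℝ) ^ (k + 1))))⁻¹ *
          ∫⁻ y in ball x ((2 : ℝ) ^ (k + 1)), ENNReal.ofReal |g y| := by
        gcongr with y
        · intro y hy
          rw [mem_ball, dist_comm, dist_eq_norm]
          exact hy.2.trans_lt (zpow_lt_zpow_right₀ (by norm_num) (by lia))
        · exact le_abs_self _
    _ ≤ maximalFn n g x :=
        le_iSup_of_le x <| le_iSup_of_le _ <| le_iSup_of_le hk' <|
          le_iSup_of_le (mem_ball_self hk') le_rfl

/-- A dyadic annulus average is controlled by the total integral. -/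
lemma annulus_average_le_lintegral (n : ℕ) (g : En n → ℝ≥0∞) (x : En n) (k : ℤ) :
    (volume (ball x ((2 : ℝ) ^ k)))⁻¹ *
        ∫⁻ y in {y : En n | (2 : ℝ) ^ (k - 1) ≤ ‖x - y‖ ∧ ‖x - y‖ ≤ (2 : ℝ) ^ k}, g y ≤
      ENNReal.ofReal ((volume (ball (0 : En n) 1)).toReal⁻¹ * 2 ^ (-((k : ℝ) * n))) *
        ∫⁻ y, g y := by
  have hk : (0 : ℝ) < 2 ^ k := by positivity
  have hv : 0 < (volume (ball (0 : En n) 1)).toReal :=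
    ENNReal.toReal_pos (measure_ball_pos _ _ one_pos).ne' measure_ball_lt_top.ne
  have hpow : (2 : ℝ) ^ (-((k : ℝ) * n)) = (((2 : ℝ) ^ k) ^ n)⁻¹ := by
    rw [Real.rpow_neg (by norm_num), Real.rpow_mul (by norm_num), Real.rpow_intCast,
      Real.rpow_natCast]
  have hvol : (volume (ball x ((2 : ℝ) ^ k)))⁻¹ =
      ENNReal.ofReal ((volume (ball (0 : En n) 1)).toReal⁻¹ * 2 ^ (-((k : ℝ) * n))) := by
    rw [hpow, ← mul_inv, ENNReal.ofReal_inv_of_pos (by positivity), mul_comm,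
      ENNReal.ofReal_mul (by positivity), ENNReal.ofReal_toReal measure_ball_lt_top.ne,
      Measure.addHaar_ball_of_pos _ _ hk, finrank_euclideanSpace_fin]
  rw [hvol]
  gcongr
  exact Measure.restrict_le_self

/-- If `I = m 2 ^ (ρ n)`, the two bounds `A ≤ L m` and `A ≤ L I 2 ^ (-k n)` balance at `k = ρ` and
give geometric decay away from this scale. -/
lemma scaled_rpow_le_of_two_bounds {n q β δ m L A ρ : ℝ} (hq : 0 < q) (hm : 0 < m)
    (hL : 0 < L) (hA : 0 ≤ A) (hδβ : δ ≤ β) (hδγ : δ ≤ n / q - β) (hδ : 0 ≤ δ) (k : ℤ)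
    (h₁ : A ≤ L * m) (h₂ : A ≤ L * 2 ^ (-((k : ℝ) * n)) * (m * 2 ^ (ρ * n))) :
    (2 : ℝ) ^ ((k : ℝ) * β) * A ^ (1 / q) ≤
      L ^ (1 / q) * 2 ^ (n / q - β) * ((2 : ℝ) ^ (-δ)) ^ (k - ⌊ρ⌋).natAbs *
        (m ^ (1 / q) * 2 ^ (ρ * β)) := by
  have hq' : 0 ≤ 1 / q := by positivity
  have hfl := Int.floor_le ρ
  have hfl' := Int.lt_floor_add_one ρ
  have hdecay : ((2 : ℝ) ^ (-δ)) ^ (k - ⌊ρ⌋).natAbs = 2 ^ (-δ * |(k : ℝ) - ⌊ρ⌋|) := by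
    rw [← Real.rpow_natCast, ← Real.rpow_mul (by norm_num), Nat.cast_natAbs]
    push_cast
    rfl
  rw [hdecay]
  suffices hs : ∃ e : ℝ, A ^ (1 / q) ≤ L ^ (1 / q) * m ^ (1 / q) * 2 ^ e ∧
      k * β + e ≤ n / q - β + -δ * |(k : ℝ) - ⌊ρ⌋| + ρ * β by
    obtain ⟨e, he, hle⟩ := hs
    calc (2 : ℝ) ^ ((k : ℝ) * β) * A ^ (1 / q)
        ≤ 2 ^ ((k : ℝ) * β) * (L ^ (1 / q) * m ^ (1 / q) * 2 ^ e) := by gcongr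
      _ = L ^ (1 / q) * m ^ (1 / q) * 2 ^ (k * β + e) := by
          rw [Real.rpow_add (by norm_num)]; ring
      _ ≤ L ^ (1 / q) * m ^ (1 / q) * 2 ^ (n / q - β + -δ * |(k : ℝ) - ⌊ρ⌋| + ρ * β) := by
          gcongr
          norm_num
      _ = _ := by
          rw [Real.rpow_add (by norm_num), Real.rpow_add (by norm_num)]; ring
  rcases le_or_gt k ⌊ρ⌋ with hk | hk
  · have hk' : (k : ℝ) ≤ ⌊ρ⌋ := by exact_mod_cast hk
    refine ⟨0, ?_, ?_⟩
    · rw [Real.rpow_zero, mul_one, ← Real.mul_rpow hL.le hm.le]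
      gcongr
    · rw [abs_of_nonpos (by linarith)]
      nlinarith [mul_nonneg (sub_nonneg.2 hδβ) (sub_nonneg.2 hk'),
        mul_nonneg (hδ.trans hδβ) (sub_nonneg.2 hfl)]
  · have hk' : (⌊ρ⌋ : ℝ) ≤ k := by exact_mod_cast hk.le
    refine ⟨(-((k : ℝ) * n) + ρ * n) * (1 / q), ?_, ?_⟩
    · rw [Real.rpow_mul (by norm_num), ← Real.mul_rpow hL.le hm.le,
        ← Real.mul_rpow (by positivity) (by positivity), Real.rpow_add (by norm_num)]
      gcongr
      linarith
    · rw [abs_of_nonneg (by linarith)]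
      have : (-((k : ℝ) * n) + ρ * n) * (1 / q) = (ρ - k) * (n / q) := by ring
      rw [this]
      nlinarith [mul_nonneg (sub_nonneg.2 hδγ) (sub_nonneg.2 hk'),
        mul_nonneg (hδ.trans hδγ) (sub_nonneg.2 hfl'.le)]

/-- Two-sided geometric series over `ℤ` converge. -/
lemma summable_pow_natAbs {r : ℝ} (h₀ : 0 ≤ r) (h₁ : r < 1) :
    Summable fun k : ℤ => r ^ k.natAbs := by
  refine Summable.of_nat_of_neg ?_ ?_ <;> simpa using summable_geometric_of_lt_one h₀ h₁

/-- The total integral of `‖f‖ ^ q` in terms of the `L^q` seminorm. -/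
lemma lintegral_ofReal_norm_rpow {X E : Type*} [MeasurableSpace X] [NormedAddCommGroup E]
    {μ : Measure X} {f : X → E} {q : ℝ} (hq : 0 < q) (hf : MemLp f (ENNReal.ofReal q) μ) :
    ∫⁻ y, ENNReal.ofReal (‖f y‖ ^ q) ∂μ =
      ENNReal.ofReal ((eLpNorm f (ENNReal.ofReal q) μ).toReal ^ q) := by
  rw [← ENNReal.ofReal_rpow_of_nonneg ENNReal.toReal_nonneg hq.le,
    ENNReal.ofReal_toReal hf.eLpNorm_ne_top,
    eLpNorm_eq_lintegral_rpow_enorm_toReal (by simpa using hq) ENNReal.ofReal_ne_top,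
    ENNReal.toReal_ofReal hq.le, ← ENNReal.rpow_mul, one_div_mul_cancel hq.ne',
    ENNReal.rpow_one]
  refine lintegral_congr fun y => ?_
  rw [← ENNReal.ofReal_rpow_of_nonneg (norm_nonneg _) hq.le, ofReal_norm]

/-- The gradient of a compactly supported `C¹` function is continuous with compact support. -/
lemma continuous_gradient_and_hasCompactSupport {E : Type*} [NormedAddCommGroup E]
    [InnerProductSpace ℝ E] [CompleteSpace E] {φ : E → ℝ} (hφ : ContDiff ℝ 1 φ)
    (hc : HasCompactSupport φ) : Continuous (gradient φ) ∧ HasCompactSupport (gradient φ) :=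
  ⟨(InnerProductSpace.toDual ℝ E).symm.continuous.comp (hφ.continuous_fderiv one_ne_zero),
    (hc.fderiv ℝ).comp_left (g := (InnerProductSpace.toDual ℝ E).symm) (map_zero _)⟩

/-- The dyadic annulus sum bound for an arbitrary nonzero `f ∈ L^q`, with exponent `β = 1 + α`. -/
lemma exists_annulus_sum_le (n : ℕ) (hn : 1 ≤ n) (q β : ℝ) (hq : 0 < q) (hβ : 0 < β)
    (h : β * q < n) :
    ∃ C > (0 : ℝ), ∀ f : En n → En n, MemLp f (ENNReal.ofReal q) volume →
      eLpNorm f (ENNReal.ofReal q) volume ≠ 0 → ∀ x : En n,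
      (∑' k : ℤ, ENNReal.ofReal ((2 : ℝ) ^ ((k : ℝ) * β)) *
          ((volume (ball x ((2 : ℝ) ^ k)))⁻¹ *
            ∫⁻ y in {y : En n | (2 : ℝ) ^ (k - 1) ≤ ‖x - y‖ ∧ ‖x - y‖ ≤ (2 : ℝ) ^ k},
              ENNReal.ofReal (‖f y‖ ^ q)) ^ (1 / q)) ≤
        ENNReal.ofReal C *
          (maximalFn n (fun y => ‖f y‖ ^ q) x) ^ (1 / q - β / (n : ℝ)) *
          ENNReal.ofReal
            ((eLpNorm f (ENNReal.ofReal q) volume).toReal ^ (q * β / (n : ℝ))) := by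
  have hn' : (0 : ℝ) < n := by exact_mod_cast hn
  have hγ : 0 < n / q - β := by rwa [sub_pos, lt_div_iff₀ hq]
  have hexp : 0 < 1 / q - β / n := by
    rw [sub_pos, div_lt_div_iff₀ hn' hq]; linarith
  set v := (volume (ball (0 : En n) 1)).toReal
  set δ := min β (n / q - β)
  have hδ : 0 < δ := lt_min hβ hγ
  set L : ℝ := max (2 ^ n) v⁻¹
  have hL : 0 < L := lt_max_of_lt_left (by positivity)
  set r : ℝ := 2 ^ (-δ)
  have hr₀ : 0 < r := by positivity
  have hr₁ : r < 1 := Real.rpow_lt_one_of_one_lt_of_neg (by norm_num) (by linarith)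
  have hsum := summable_pow_natAbs hr₀.le hr₁
  have hsum_pos : 0 < ∑' j : ℤ, r ^ j.natAbs :=
    hsum.tsum_pos (fun _ => by positivity) 0 (by simp)
  set K : ℝ := L ^ (1 / q) * 2 ^ (n / q - β)
  have hK : 0 < K := by positivity
  refine ⟨K * ∑' j : ℤ, r ^ j.natAbs, by positivity, fun f hf hf₀ x => ?_⟩
  set N := (eLpNorm f (ENNReal.ofReal q) volume).toReal
  have hN : 0 < N := ENNReal.toReal_pos hf₀ hf.eLpNorm_ne_top
  set M := maximalFn n (fun y => ‖f y‖ ^ q) x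
  set A : ℤ → ℝ≥0∞ := fun k => (volume (ball x ((2 : ℝ) ^ k)))⁻¹ *
    ∫⁻ y in {y : En n | (2 : ℝ) ^ (k - 1) ≤ ‖x - y‖ ∧ ‖x - y‖ ≤ (2 : ℝ) ^ k},
      ENNReal.ofReal (‖f y‖ ^ q)
  change ∑' k : ℤ, ENNReal.ofReal ((2 : ℝ) ^ ((k : ℝ) * β)) * A k ^ (1 / q) ≤ _
  have hA₁ (k : ℤ) : A k ≤ ENNReal.ofReal (2 ^ n) * M := annulus_average_le_maximalFn n _ x k
  have hA₂ (k : ℤ) : A k ≤ ENNReal.ofReal (v⁻¹ * 2 ^ (-((k : ℝ) * n)) * N ^ q) := by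
    rw [ENNReal.ofReal_mul (by positivity), ← lintegral_ofReal_norm_rpow hq hf]
    exact annulus_average_le_lintegral n _ x k
  clear_value M
  rcases eq_or_ne M 0 with rfl | hM₀
  · have hA (k : ℤ) : A k = 0 := by simpa using hA₁ k
    simp [hA, hq]
  rcases eq_or_ne M ⊤ with rfl | hM_top
  · rw [ENNReal.top_rpow_of_pos hexp, ENNReal.mul_top, ENNReal.top_mul]
    · exact le_top
    · simp only [ne_eq, ENNReal.ofReal_eq_zero, not_le]; positivity
    · simp only [ne_eq, ENNReal.ofReal_eq_zero, not_le]; positivity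
  set m := M.toReal
  have hm : 0 < m := ENNReal.toReal_pos hM₀ hM_top
  have hMm : M = ENNReal.ofReal m := (ENNReal.ofReal_toReal hM_top).symm
  set ρ : ℝ := Real.logb 2 (N ^ q / m) / n
  have hρ : m * 2 ^ (ρ * n) = N ^ q := by
    rw [div_mul_cancel₀ _ hn'.ne', Real.rpow_logb (by norm_num) (by norm_num) (by positivity)]
    field_simp
  have hbalance : m ^ (1 / q) * 2 ^ (ρ * β) = m ^ (1 / q - β / n) * N ^ (q * β / n) := by
    rw [mul_div_assoc, Real.rpow_mul hN.le, ← hρ, Real.mul_rpow hm.le (by positivity), ← mul_assoc,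
      ← Real.rpow_add hm, ← Real.rpow_mul (by norm_num)]
    congr 2
    · ring
    · field_simp
  have hterm (k : ℤ) : ENNReal.ofReal ((2 : ℝ) ^ ((k : ℝ) * β)) * A k ^ (1 / q) ≤
      ENNReal.ofReal (K * r ^ (k - ⌊ρ⌋).natAbs * (m ^ (1 / q - β / n) * N ^ (q * β / n))) := by
    have hA_top : A k ≠ ⊤ := ne_top_of_le_ne_top ENNReal.ofReal_ne_top (hA₂ k)
    rw [← ENNReal.ofReal_toReal hA_top, ENNReal.ofReal_rpow_of_nonneg ENNReal.toReal_nonneg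
      (by positivity), ← ENNReal.ofReal_mul (by positivity), ← hbalance]
    refine ENNReal.ofReal_le_ofReal (scaled_rpow_le_of_two_bounds hq hm hL ENNReal.toReal_nonneg
      (min_le_left _ _) (min_le_right _ _) hδ.le k ?_ ?_)
    · refine ENNReal.toReal_le_of_le_ofReal (by positivity) ((hA₁ k).trans ?_)
      rw [hMm, ← ENNReal.ofReal_mul (by positivity)]
      gcongr
      exact le_max_left _ _
    · refine ENNReal.toReal_le_of_le_ofReal (by positivity) ((hA₂ k).trans ?_)
      rw [hρ]
      gcongr
      exact le_max_right _ _
  refine (ENNReal.tsum_le_tsum hterm).trans_eq (((Equiv.subRight ⌊ρ⌋).tsum_eq fun j : ℤ =>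
      ENNReal.ofReal (K * r ^ j.natAbs * (m ^ (1 / q - β / n) * N ^ (q * β / n)))).trans ?_)
  rw [← ENNReal.ofReal_tsum_of_nonneg (fun _ => by positivity) ((hsum.mul_left K).mul_right _),
    tsum_mul_right, tsum_mul_left, hMm, ENNReal.ofReal_rpow_of_pos hm,
    ← ENNReal.ofReal_mul (by positivity), ← ENNReal.ofReal_mul (by positivity), ← mul_assoc]

/-- For `n ≥ 1`, `q > 1`, `α > 0` with `(1+α)q < n`, there is `C` such
that for every smooth compactly supported `φ` with `∇φ` not identically zero and every `x`,
the dyadic annulus sum satisfies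
`Σ_{k∈ℤ} 2^{k(1+α)} ((1/|B(x,2^k)|) ∫_{2^{k−1} ≤ |x−y| ≤ 2^k} |∇φ|^q)^{1/q}
  ≤ C (M(|∇φ|^q)(x))^{1/q−(1+α)/n} ‖∇φ‖_{L^q}^{q(1+α)/n}` (in `[0,∞]`). -/
theorem dyadic_annulus_sum_maximal_bound (n : ℕ) (hn : 1 ≤ n) (q α : ℝ)
    (hq : 1 < q) (hα : 0 < α) (h : (1 + α) * q < n) :
    ∃ C > (0 : ℝ), ∀ φ : En n → ℝ, ContDiff ℝ (⊤ : ℕ∞) φ → HasCompactSupport φ →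
      (¬ ∀ x : En n, gradient φ x = 0) → ∀ x : En n,
      (∑' k : ℤ, ENNReal.ofReal ((2 : ℝ) ^ ((k : ℝ) * (1 + α))) *
          ((volume (ball x ((2 : ℝ) ^ k)))⁻¹ *
            ∫⁻ y in {y : En n | (2 : ℝ) ^ (k - 1) ≤ ‖x - y‖ ∧ ‖x - y‖ ≤ (2 : ℝ) ^ k},
              ENNReal.ofReal (‖gradient φ y‖ ^ q)) ^ (1 / q)) ≤
        ENNReal.ofReal C *
          (maximalFn n (fun y => ‖gradient φ y‖ ^ q) x) ^ (1 / q - (1 + α) / (n : ℝ)) *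
          ENNReal.ofReal
            ((eLpNorm (fun y : En n => gradient φ y) (ENNReal.ofReal q) volume).toReal ^
              (q * (1 + α) / (n : ℝ))) := by
  obtain ⟨C, hC, hbound⟩ := exists_annulus_sum_le n hn q (1 + α) (by linarith) (by linarith) h
  refine ⟨C, hC, fun φ hφ hc hne x => ?_⟩
  obtain ⟨hcont, hsupp⟩ := continuous_gradient_and_hasCompactSupport
    (hφ.of_le (by exact_mod_cast le_top)) hc
  refine hbound (gradient φ) (hcont.memLp_of_hasCompactSupport hsupp) (fun h₀ => hne ?_) x
  have hq₀ : ENNReal.ofReal q ≠ 0 := by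
    simp only [ne_eq, ENNReal.ofReal_eq_zero, not_le]; linarith
  rw [eLpNorm_eq_zero_iff hcont.aestronglyMeasurable hq₀] at h₀
  exact congrFun ((hcont.ae_eq_iff_eq volume continuous_const).1 h₀)
end
end
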